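/- For all f, f' ∈ ℝ^{L₁×L₂×H}, kernels w, w' ∈ ℝ^{3×3×H×H'}, biases b, b' ∈ ℝ^{H'}, and skip inputs s, s' ∈ ℝ^{L₁×L₂×H'}, ‖σ(Conv(f,w) + g(b) + s) − σ(Conv(f',w') + g(b') + s')‖ ≤ 9·‖w − w'‖·‖f‖ + L₁L₂·‖b − b'‖ + 9·‖w'‖·‖f − f'‖ + ‖s − s'‖, where ‖·‖ is the Frobenius (elementwise Euclidean) norm; in particular, taking s = s' = 0 gives the perturbation bound for one convolutional layer without skip connection. -/

import Mathlib

noncomputable section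

/-- The ReLU function `σ(t) = max(t, 0)`. -/
def relu (t : ℝ) : ℝ := max t 0

/-- Zero-padded access to a tensor `f ∈ ℝ^{L₁×L₂×H}` (channels indexed by `ℕ`):
entries outside `{0,…,L₁−1} × {0,…,L₂−1}` are `0`. -/
def pad {L₁ L₂ : ℕ} (f : Fin L₁ → Fin L₂ → ℕ → ℝ) (a b : ℤ) (i : ℕ) : ℝ :=
  if h : 0 ≤ a ∧ a < (L₁ : ℤ) ∧ 0 ≤ b ∧ b < (L₂ : ℤ) then
    f ⟨a.toNat, by omega⟩ ⟨b.toNat, by omega⟩ i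
  else 0

/-- Zero-padded stride-1 convolution with a `3×3×H×H'` kernel (`H` input channels):
`Conv(f,w)_{l₁,l₂,j} = Σ_{i<H} Σ_{p,q} f_{l₁+p−1,l₂+q−1,i} w_{p,q,i,j}` (`0`-based
spatial and kernel indices, so the kernel center is `p = q = 1`). -/
def conv {L₁ L₂ : ℕ} (H : ℕ) (f : Fin L₁ → Fin L₂ → ℕ → ℝ)
    (w : Fin 3 → Fin 3 → ℕ → ℕ → ℝ) (l₁ : Fin L₁) (l₂ : Fin L₂) (j : ℕ) : ℝ :=
  ∑ i ∈ Finset.range H, ∑ p : Fin 3, ∑ q : Fin 3,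
    pad f ((l₁ : ℤ) + (p : ℤ) - 1) ((l₂ : ℤ) + (q : ℤ) - 1) i * w p q i j

/-- Frobenius norm of a tensor in `ℝ^{L₁×L₂×H}` (first `H` channels). -/
def tnorm {L₁ L₂ : ℕ} (H : ℕ) (f : Fin L₁ → Fin L₂ → ℕ → ℝ) : ℝ :=
  Real.sqrt (∑ l₁ : Fin L₁, ∑ l₂ : Fin L₂, ∑ i ∈ Finset.range H, f l₁ l₂ i ^ 2)

/-- Frobenius norm of a `3×3×H×H'` kernel. -/
def knorm (H H' : ℕ) (w : Fin 3 → Fin 3 → ℕ → ℕ → ℝ) : ℝ :=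
  Real.sqrt (∑ p : Fin 3, ∑ q : Fin 3, ∑ i ∈ Finset.range H, ∑ j ∈ Finset.range H',
    w p q i j ^ 2)

/-- Euclidean norm of a bias vector in `ℝ^{H}` (first `H` coordinates). -/
def vnorm (H : ℕ) (b : ℕ → ℝ) : ℝ := Real.sqrt (∑ j ∈ Finset.range H, b j ^ 2)


/-- `tnorm` is the norm of the associated vector of a Euclidean space. -/
theorem tnorm_eq_norm {L₁ L₂ : ℕ} (H : ℕ) (f : Fin L₁ → Fin L₂ → ℕ → ℝ) :
    tnorm H f = ‖WithLp.toLp 2 (fun x : Fin L₁ × Fin L₂ × Fin H => f x.1 x.2.1 x.2.2)‖ := by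
  simp [tnorm, EuclideanSpace.norm_eq, Fintype.sum_prod_type, Finset.sum_range]

theorem tnorm_add_le {L₁ L₂ : ℕ} (H : ℕ) (f g : Fin L₁ → Fin L₂ → ℕ → ℝ) :
    tnorm H (fun l₁ l₂ i => f l₁ l₂ i + g l₁ l₂ i) ≤ tnorm H f + tnorm H g := by
  simp only [tnorm_eq_norm]
  exact norm_add_le
    (WithLp.toLp 2 (fun x : Fin L₁ × Fin L₂ × Fin H => f x.1 x.2.1 x.2.2))
    (WithLp.toLp 2 (fun x : Fin L₁ × Fin L₂ × Fin H => g x.1 x.2.1 x.2.2))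

theorem tnorm_le_tnorm {L₁ L₂ : ℕ} {H : ℕ} {f g : Fin L₁ → Fin L₂ → ℕ → ℝ}
    (h : ∀ l₁ l₂ i, |f l₁ l₂ i| ≤ |g l₁ l₂ i|) : tnorm H f ≤ tnorm H g :=
  Real.sqrt_le_sqrt <| Finset.sum_le_sum fun l₁ _ => Finset.sum_le_sum fun l₂ _ =>
    Finset.sum_le_sum fun i _ => sq_le_sq.2 (h l₁ l₂ i)

theorem abs_relu_sub_relu_le (x y : ℝ) : |relu x - relu y| ≤ |x - y| :=
  abs_max_sub_max_le_abs x y 0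

/-- Broadcasting a bias over an `L₁ × L₂` grid multiplies its norm by `√(L₁L₂) ≤ L₁L₂`. -/
theorem tnorm_broadcast_le (L₁ L₂ H : ℕ) (b : ℕ → ℝ) :
    tnorm H (fun (_ : Fin L₁) (_ : Fin L₂) j => b j) ≤ (L₁ : ℝ) * (L₂ : ℝ) * vnorm H b := by
  have hn : (L₁ : ℝ) * L₂ ≤ ((L₁ : ℝ) * L₂) ^ 2 := by
    exact_mod_cast Nat.le_self_pow two_ne_zero (L₁ * L₂)
  refine Real.sqrt_le_iff.2 ⟨by unfold vnorm; positivity, ?_⟩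
  rw [mul_pow, vnorm, Real.sq_sqrt (Finset.sum_nonneg fun _ _ => sq_nonneg _)]
  simp only [Finset.sum_const, Finset.card_univ, Fintype.card_fin, nsmul_eq_mul, ← mul_assoc]
  exact mul_le_mul_of_nonneg_right hn (Finset.sum_nonneg fun _ _ => sq_nonneg _)

/-- Shifting a nonnegative function supported in `[0, L)` does not increase its sum
over `[0, L)`. -/
theorem sum_shift_le {L : ℕ} {g : ℤ → ℝ} (hg : ∀ z, 0 ≤ g z)
    (hsupp : ∀ z, g z ≠ 0 → 0 ≤ z ∧ z < L) (c : ℤ) :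
    ∑ l : Fin L, g (l + c) ≤ ∑ l : Fin L, g l := by
  have hinj : ∀ d : ℤ, Function.Injective fun l : Fin L => (l : ℤ) + d := fun d l m h => by
    have : (l : ℤ) + d = m + d := h
    omega
  have himage : ∀ d : ℤ, ∑ l : Fin L, g (l + d)
      = ∑ z ∈ Finset.univ.image fun l : Fin L => (l : ℤ) + d, g z := fun d =>
    (Finset.sum_image fun x _ y _ h => hinj d h).symm
  have h0 := himage 0
  simp only [add_zero] at h0
  rw [himage, h0, ← Finset.sum_filter_ne_zero]
  refine Finset.sum_le_sum_of_subset_of_nonneg (fun z hz => ?_) fun z _ _ => hg z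
  obtain ⟨hz0, hzL⟩ := hsupp z (Finset.mem_filter.1 hz).2
  exact Finset.mem_image.2 ⟨⟨z.toNat, by omega⟩, Finset.mem_univ _, by simp [hz0]⟩

theorem pad_coe {L₁ L₂ : ℕ} (f : Fin L₁ → Fin L₂ → ℕ → ℝ) (l₁ : Fin L₁) (l₂ : Fin L₂) (i : ℕ) :
    pad f l₁ l₂ i = f l₁ l₂ i := by
  simp [pad]

theorem pad_sub {L₁ L₂ : ℕ} (f f' : Fin L₁ → Fin L₂ → ℕ → ℝ) (a b : ℤ) (i : ℕ) :
    pad (fun l₁ l₂ i => f l₁ l₂ i - f' l₁ l₂ i) a b i = pad f a b i - pad f' a b i := by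
  unfold pad
  split_ifs <;> simp

theorem mem_range_of_pad_ne_zero {L₁ L₂ : ℕ} {f : Fin L₁ → Fin L₂ → ℕ → ℝ} {a b : ℤ} {i : ℕ}
    (h : pad f a b i ≠ 0) : (0 ≤ a ∧ a < L₁) ∧ 0 ≤ b ∧ b < L₂ := by
  by_contra hab
  exact h (dif_neg fun ⟨h₁, h₂, h₃, h₄⟩ => hab ⟨⟨h₁, h₂⟩, h₃, h₄⟩)

theorem sum_pad_sq_le {L₁ L₂ : ℕ} (f : Fin L₁ → Fin L₂ → ℕ → ℝ) (c d : ℤ) (i : ℕ) :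
    ∑ l₁ : Fin L₁, ∑ l₂ : Fin L₂, pad f (l₁ + c) (l₂ + d) i ^ 2
      ≤ ∑ l₁ : Fin L₁, ∑ l₂ : Fin L₂, f l₁ l₂ i ^ 2 := by
  calc ∑ l₁ : Fin L₁, ∑ l₂ : Fin L₂, pad f (l₁ + c) (l₂ + d) i ^ 2
      ≤ ∑ l₁ : Fin L₁, ∑ l₂ : Fin L₂, pad f (l₁ + c) l₂ i ^ 2 :=
        Finset.sum_le_sum fun l₁ _ => sum_shift_le (g := fun z => pad f (l₁ + c) z i ^ 2)
          (fun _ => sq_nonneg _)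
          (fun _ h => (mem_range_of_pad_ne_zero (ne_zero_pow two_ne_zero h)).2) d
    _ ≤ ∑ l₁ : Fin L₁, ∑ l₂ : Fin L₂, pad f l₁ l₂ i ^ 2 := by
        refine sum_shift_le (g := fun z => ∑ l₂ : Fin L₂, pad f z l₂ i ^ 2)
          (fun _ => Finset.sum_nonneg fun _ _ => sq_nonneg _) (fun _ h => ?_) c
        obtain ⟨_, _, h⟩ := Finset.exists_ne_zero_of_sum_ne_zero h
        exact (mem_range_of_pad_ne_zero (ne_zero_pow two_ne_zero h)).1
    _ = ∑ l₁ : Fin L₁, ∑ l₂ : Fin L₂, f l₁ l₂ i ^ 2 := by simp only [pad_coe]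

/-- Cauchy–Schwarz over the receptive field of one output entry. -/
theorem conv_sq_le {L₁ L₂ : ℕ} (H : ℕ) (f : Fin L₁ → Fin L₂ → ℕ → ℝ)
    (w : Fin 3 → Fin 3 → ℕ → ℕ → ℝ) (l₁ : Fin L₁) (l₂ : Fin L₂) (j : ℕ) :
    conv H f w l₁ l₂ j ^ 2 ≤
      (∑ i ∈ Finset.range H, ∑ p : Fin 3, ∑ q : Fin 3,
        pad f (l₁ + ((p : ℤ) - 1)) (l₂ + ((q : ℤ) - 1)) i ^ 2) *
      ∑ i ∈ Finset.range H, ∑ p : Fin 3, ∑ q : Fin 3, w p q i j ^ 2 := by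
  have h := Finset.sum_mul_sq_le_sq_mul_sq
    (Finset.range H ×ˢ (Finset.univ : Finset (Fin 3 × Fin 3)))
    (fun x => pad f (l₁ + ((x.2.1 : ℤ) - 1)) (l₂ + ((x.2.2 : ℤ) - 1)) x.1)
    (fun x => w x.2.1 x.2.2 x.1 j)
  simp only [Finset.sum_product, Fintype.sum_prod_type] at h
  simpa only [conv, add_sub_assoc] using h

theorem tnorm_conv_le {L₁ L₂ : ℕ} (H H' : ℕ) (f : Fin L₁ → Fin L₂ → ℕ → ℝ)
    (w : Fin 3 → Fin 3 → ℕ → ℕ → ℝ) :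
    tnorm H' (conv H f w) ≤ 9 * knorm H H' w * tnorm H f := by
  set F := ∑ l₁ : Fin L₁, ∑ l₂ : Fin L₂, ∑ i ∈ Finset.range H, f l₁ l₂ i ^ 2 with hF
  set W := ∑ p : Fin 3, ∑ q : Fin 3, ∑ i ∈ Finset.range H, ∑ j ∈ Finset.range H',
    w p q i j ^ 2 with hW
  have hF0 : 0 ≤ F := by positivity
  have hW0 : 0 ≤ W := by positivity
  have hpad : ∑ l₁ : Fin L₁, ∑ l₂ : Fin L₂, ∑ i ∈ Finset.range H, ∑ p : Fin 3, ∑ q : Fin 3,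
      pad f (l₁ + ((p : ℤ) - 1)) (l₂ + ((q : ℤ) - 1)) i ^ 2 ≤ 9 * F := by
    calc _ = ∑ p : Fin 3, ∑ q : Fin 3, ∑ i ∈ Finset.range H, ∑ l₁ : Fin L₁, ∑ l₂ : Fin L₂,
          pad f (l₁ + ((p : ℤ) - 1)) (l₂ + ((q : ℤ) - 1)) i ^ 2 := by
          simp only [Finset.sum_comm (s := (Finset.univ : Finset (Fin L₂)))
            (t := Finset.range H), Finset.sum_comm (s := (Finset.univ : Finset (Fin L₁)))
            (t := Finset.range H), Finset.sum_comm (s := (Finset.univ : Finset (Fin L₂)))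
            (t := (Finset.univ : Finset (Fin 3))),
            Finset.sum_comm (s := (Finset.univ : Finset (Fin L₁)))
            (t := (Finset.univ : Finset (Fin 3))),
            Finset.sum_comm (s := Finset.range H)
            (t := (Finset.univ : Finset (Fin 3)))]
      _ ≤ ∑ p : Fin 3, ∑ q : Fin 3, ∑ i ∈ Finset.range H, ∑ l₁ : Fin L₁, ∑ l₂ : Fin L₂,
          f l₁ l₂ i ^ 2 :=
          Finset.sum_le_sum fun _ _ => Finset.sum_le_sum fun _ _ => Finset.sum_le_sum fun _ _ =>
            sum_pad_sq_le f _ _ _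
      _ = 9 * F := by
          have hswap : ∑ i ∈ Finset.range H, ∑ l₁ : Fin L₁, ∑ l₂ : Fin L₂, f l₁ l₂ i ^ 2 = F := by
            rw [Finset.sum_comm]
            exact Finset.sum_congr rfl fun _ _ => Finset.sum_comm
          simp only [hswap, Finset.sum_const, Finset.card_univ, Fintype.card_fin, nsmul_eq_mul]
          ring
  have hker : ∑ j ∈ Finset.range H', ∑ i ∈ Finset.range H, ∑ p : Fin 3, ∑ q : Fin 3,
      w p q i j ^ 2 = W := by
    rw [Finset.sum_comm]
    simp only [hW, Finset.sum_comm (s := Finset.range H')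
      (t := (Finset.univ : Finset (Fin 3))), Finset.sum_comm (s := Finset.range H)
      (t := (Finset.univ : Finset (Fin 3)))]
  refine Real.sqrt_le_iff.2 ⟨by unfold knorm tnorm; positivity, ?_⟩
  calc ∑ l₁ : Fin L₁, ∑ l₂ : Fin L₂, ∑ j ∈ Finset.range H', conv H f w l₁ l₂ j ^ 2
      ≤ ∑ l₁ : Fin L₁, ∑ l₂ : Fin L₂, ∑ j ∈ Finset.range H', _ :=
        Finset.sum_le_sum fun l₁ _ => Finset.sum_le_sum fun l₂ _ => Finset.sum_le_sum fun j _ =>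
          conv_sq_le H f w l₁ l₂ j
    _ = (∑ l₁ : Fin L₁, ∑ l₂ : Fin L₂, ∑ i ∈ Finset.range H, ∑ p : Fin 3, ∑ q : Fin 3,
          pad f (l₁ + ((p : ℤ) - 1)) (l₂ + ((q : ℤ) - 1)) i ^ 2) * W := by
        simp only [← Finset.mul_sum, hker, ← Finset.sum_mul]
    _ ≤ 9 * F * W := mul_le_mul_of_nonneg_right hpad hW0
    _ ≤ (9 * knorm H H' w * tnorm H f) ^ 2 := by
        rw [mul_pow, mul_pow, knorm, tnorm, ← hF, ← hW, Real.sq_sqrt hF0, Real.sq_sqrt hW0]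
        nlinarith [mul_nonneg hF0 hW0]

theorem conv_sub_conv {L₁ L₂ : ℕ} (H : ℕ) (f f' : Fin L₁ → Fin L₂ → ℕ → ℝ)
    (w w' : Fin 3 → Fin 3 → ℕ → ℕ → ℝ) (l₁ : Fin L₁) (l₂ : Fin L₂) (j : ℕ) :
    conv H f w l₁ l₂ j - conv H f' w' l₁ l₂ j =
      conv H f (fun p q i j => w p q i j - w' p q i j) l₁ l₂ j +
        conv H (fun l₁ l₂ i => f l₁ l₂ i - f' l₁ l₂ i) w' l₁ l₂ j := by
  simp only [conv, pad_sub, ← Finset.sum_sub_distrib, ← Finset.sum_add_distrib]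
  refine Finset.sum_congr rfl fun _ _ => Finset.sum_congr rfl fun _ _ =>
    Finset.sum_congr rfl fun _ _ => ?_
  ring

/-- perturbation bound for one convolutional layer with skip input.
For all `f, f' ∈ ℝ^{L₁×L₂×H}`, kernels `w, w' ∈ ℝ^{3×3×H×H'}`, biases
`b, b' ∈ ℝ^{H'}` and skip inputs `s, s' ∈ ℝ^{L₁×L₂×H'}`,
`‖σ(Conv(f,w) + g(b) + s) − σ(Conv(f',w') + g(b') + s')‖
  ≤ 9‖w − w'‖‖f‖ + L₁L₂‖b − b'‖ + 9‖w'‖‖f − f'‖ + ‖s − s'‖`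
(Frobenius norms); taking `s = s' = 0` gives the bound for a layer without skip
connection. -/
theorem conv_layer_perturbation_bound (L₁ L₂ H H' : ℕ)
    (f f' : Fin L₁ → Fin L₂ → ℕ → ℝ) (w w' : Fin 3 → Fin 3 → ℕ → ℕ → ℝ)
    (b b' : ℕ → ℝ) (s s' : Fin L₁ → Fin L₂ → ℕ → ℝ) :
    tnorm H' (fun l₁ l₂ j =>
        relu (conv H f w l₁ l₂ j + b j + s l₁ l₂ j)
          - relu (conv H f' w' l₁ l₂ j + b' j + s' l₁ l₂ j))
      ≤ 9 * knorm H H' (fun p q i j => w p q i j - w' p q i j) * tnorm H f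
        + (L₁ : ℝ) * (L₂ : ℝ) * vnorm H' (fun j => b j - b' j)
        + 9 * knorm H H' w' * tnorm H (fun l₁ l₂ i => f l₁ l₂ i - f' l₁ l₂ i)
        + tnorm H' (fun l₁ l₂ j => s l₁ l₂ j - s' l₁ l₂ j) := by
  set C₁ := conv H f (fun p q i j => w p q i j - w' p q i j)
  set C₂ := conv H (fun l₁ l₂ i => f l₁ l₂ i - f' l₁ l₂ i) w'
  calc _ ≤ tnorm H' (fun l₁ l₂ j =>
          C₁ l₁ l₂ j + (b j - b' j) + C₂ l₁ l₂ j + (s l₁ l₂ j - s' l₁ l₂ j)) := by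
        refine tnorm_le_tnorm fun l₁ l₂ j => (abs_relu_sub_relu_le _ _).trans_eq ?_
        congr 1
        linear_combination conv_sub_conv H f f' w w' l₁ l₂ j
    _ ≤ tnorm H' C₁ + tnorm H' (fun (_ : Fin L₁) (_ : Fin L₂) j => b j - b' j) + tnorm H' C₂
          + tnorm H' (fun l₁ l₂ j => s l₁ l₂ j - s' l₁ l₂ j) := by
        refine (tnorm_add_le H' _ _).trans (add_le_add_left ?_ _)
        refine (tnorm_add_le H' _ _).trans (add_le_add_left ?_ _)
        exact tnorm_add_le H' _ _
    _ ≤ _ := by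
        gcongr
        · exact tnorm_conv_le H H' f _
        · exact tnorm_broadcast_le L₁ L₂ H' _
        · exact tnorm_conv_le H H' _ w'

end
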